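/- Let f, g : ℕ → ℕ be strictly increasing functions such that f(n) ≤ g(n) for all n and lim_{n→∞} f(n)/g(n) = c for some c ∈ (0,1). Then for every ρ, ρ ∈ P(G(f)) implies c²·ρ ∈ P(G(g)). -/

import Mathlib

open Filter Asymptotics

/-- Membership in the grid `[-f n, f n]^2 ⊆ ℤ × ℤ`. -/
def inGrid (f : ℕ → ℕ) (n : ℕ) (p : ℤ × ℤ) : Prop :=
  |p.1| ≤ (f n : ℤ) ∧ |p.2| ≤ (f n : ℤ)

instance (f : ℕ → ℕ) (n : ℕ) : DecidablePred (inGrid f n) := fun _ => by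
  unfold inGrid; infer_instance

/-- The four lattice neighbours (at `L¹`-distance one) of a point. -/
def nbrs (p : ℤ × ℤ) : Finset (ℤ × ℤ) :=
  {(p.1 + 1, p.2), (p.1 - 1, p.2), (p.1, p.2 + 1), (p.1, p.2 - 1)}

/-- An activator sequence: whenever `V n ≠ ∅` (for `n ≥ 1`), the activated vertex
lies in the grid at time `n`. -/
def IsActivator (f : ℕ → ℕ) (V : ℕ → Option (ℤ × ℤ)) : Prop :=
  ∀ n, 1 ≤ n → ∀ p, V n = some p → inGrid f n p

/-- The burning process: `B 0 = ∅`, and `B n` is obtained from `B (n-1)` by adding all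
vertices of the grid at time `n` adjacent to a vertex of `B (n-1)`, and then adding
the activator `V n` if it is not `∅`. -/
def burnSet (f : ℕ → ℕ) (V : ℕ → Option (ℤ × ℤ)) : ℕ → Finset (ℤ × ℤ)
  | 0 => ∅
  | n + 1 =>
    let B := burnSet f V n
    let spread := B ∪ (B.biUnion nbrs).filter (inGrid f (n + 1))
    match V (n + 1) with
    | none => spread
    | some v => insert v spread

/-- The proportion `|B n| / |V(G n)|` of burning vertices at time `n`. -/
noncomputable def densitySeq (f : ℕ → ℕ) (V : ℕ → Option (ℤ × ℤ)) (n : ℕ) : ℝ :=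
  ((burnSet f V n).card : ℝ) / (2 * (f n : ℝ) + 1) ^ 2

/-- The lower burning density `δ̲(G(f), V)`. -/
noncomputable def lowerDensity (f : ℕ → ℕ) (V : ℕ → Option (ℤ × ℤ)) : ℝ :=
  liminf (densitySeq f V) atTop

/-- The upper burning density `δ̄(G(f), V)`. -/
noncomputable def upperDensity (f : ℕ → ℕ) (V : ℕ → Option (ℤ × ℤ)) : ℝ :=
  limsup (densitySeq f V) atTop

/-- The burning density of `V` in `G(f)` exists and equals `ρ`. -/
def HasBurningDensity (f : ℕ → ℕ) (V : ℕ → Option (ℤ × ℤ)) (ρ : ℝ) : Prop :=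
  Tendsto (densitySeq f V) atTop (nhds ρ)

/-- `P(G(f))`: the set of `ρ ∈ [0,1]` achievable as the burning density of some
non-empty activator sequence. -/
def densSet (f : ℕ → ℕ) : Set ℝ :=
  {ρ | ρ ∈ Set.Icc (0 : ℝ) 1 ∧
    ∃ V : ℕ → Option (ℤ × ℤ), IsActivator f V ∧ (∃ t, 1 ≤ t ∧ V t ≠ none) ∧
      HasBurningDensity f V ρ}

/-- The controlled growth requirement. -/
def ControlledGrowth (f : ℕ → ℕ) : Prop :=
  (∀ᶠ n in atTop, f n < f (n + 1)) ∧
  (∀ ε : ℕ → ℕ, (fun n => (ε n : ℝ)) =o[atTop] (fun n => (n : ℝ)) →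
    Tendsto (fun n => (f (n + ε n) : ℝ) / (f n : ℝ)) atTop (nhds 1)) ∧
  (∀ c : ℝ, 0 < c → ∃ d : ℝ, 0 < d ∧
    ∀ᶠ n in atTop, (1 + d) * (f n : ℝ) ≤ (f (n + ⌈c * n⌉₊) : ℝ))

theorem mem_burnSet_succ {f : ℕ → ℕ} {V : ℕ → Option (ℤ × ℤ)} {n : ℕ} {p : ℤ × ℤ} :
    p ∈ burnSet f V (n + 1) ↔ p ∈ burnSet f V n ∨
      ((∃ q ∈ burnSet f V n, p ∈ nbrs q) ∧ inGrid f (n + 1) p) ∨ V (n + 1) = some p := by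
  cases h : V (n + 1) with
  | none => simp [burnSet, h]
  | some v =>
    simp only [burnSet, h, Finset.mem_insert, Finset.mem_union, Finset.mem_filter,
      Finset.mem_biUnion, Option.some.injEq]
    grind

theorem inGrid.succ {f : ℕ → ℕ} (hf : StrictMono f) {n : ℕ} {p : ℤ × ℤ} (h : inGrid f n p) :
    inGrid f (n + 1) p := by
  have := hf n.lt_add_one
  unfold inGrid at *
  omega

theorem inGrid.succ_of_mem_nbrs {f : ℕ → ℕ} (hf : StrictMono f) {n : ℕ} {p q : ℤ × ℤ}
    (h : inGrid f n q) (hp : p ∈ nbrs q) : inGrid f (n + 1) p := by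
  have := hf n.lt_add_one
  simp only [nbrs, Finset.mem_insert, Finset.mem_singleton] at hp
  unfold inGrid at *
  simp only [abs_le] at *
  rcases hp with rfl | rfl | rfl | rfl <;> dsimp only <;> omega

theorem inGrid_of_mem_burnSet {f : ℕ → ℕ} (hf : StrictMono f) {V : ℕ → Option (ℤ × ℤ)}
    (hV : IsActivator f V) (n : ℕ) : ∀ p ∈ burnSet f V n, inGrid f n p := by
  induction n with
  | zero => simp [burnSet]
  | succ n ih =>
    intro p hp
    rcases mem_burnSet_succ.1 hp with h | ⟨-, h⟩ | h
    · exact (ih p h).succ hf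
    · exact h
    · exact hV _ (Nat.succ_pos n) p h

theorem inGrid.mono {f g : ℕ → ℕ} {n : ℕ} (hle : f n ≤ g n) {p : ℤ × ℤ} (h : inGrid f n p) :
    inGrid g n p := by
  unfold inGrid at *
  omega

/-- On strictly growing grids the boundary never obstructs the fire, so enlarging the grids
does not change the burning sets. -/
theorem burnSet_eq_of_le {f g : ℕ → ℕ} (hf : StrictMono f) (hle : ∀ n, f n ≤ g n)
    {V : ℕ → Option (ℤ × ℤ)} (hV : IsActivator f V) (n : ℕ) :
    burnSet g V n = burnSet f V n := by
  induction n with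
  | zero => rfl
  | succ n ih =>
    ext p
    rw [mem_burnSet_succ, mem_burnSet_succ, ih]
    have key : ∀ q ∈ burnSet f V n, p ∈ nbrs q → inGrid f (n + 1) p := fun q hq hp =>
      (inGrid_of_mem_burnSet hf hV n q hq).succ_of_mem_nbrs hf hp
    have hmono : inGrid f (n + 1) p → inGrid g (n + 1) p := inGrid.mono (hle _)
    grind

theorem tendsto_two_mul_add_one_div {f g : ℕ → ℕ} (hg : StrictMono g) {c : ℝ}
    (hlim : Tendsto (fun n => (f n : ℝ) / (g n : ℝ)) atTop (nhds c)) :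
    Tendsto (fun n => (2 * (f n : ℝ) + 1) / (2 * (g n : ℝ) + 1)) atTop (nhds c) := by
  have hinv : Tendsto (fun n => ((g n : ℝ))⁻¹) atTop (nhds 0) :=
    tendsto_inv_atTop_zero.comp (tendsto_natCast_atTop_atTop.comp hg.tendsto_atTop)
  have h := ((hlim.const_mul 2).add hinv).div (hinv.const_add 2) (by norm_num)
  rw [show (2 * c + 0) / (2 + 0) = c by ring] at h
  refine h.congr' ?_
  filter_upwards [eventually_gt_atTop 0] with n hn
  have : (0 : ℝ) < g n := by exact_mod_cast (Nat.zero_le _).trans_lt (hg hn)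
  simp only [Pi.div_apply]
  field_simp

/-- if `f ≤ g` are strictly increasing and `f(n)/g(n) → c ∈ (0,1)`,
then `ρ ∈ P(G(f))` implies `c² ρ ∈ P(G(g))`. -/
theorem densSet_scaling (f g : ℕ → ℕ) (hf : StrictMono f) (hg : StrictMono g)
    (hle : ∀ n, f n ≤ g n) (c : ℝ) (hc0 : 0 < c) (hc1 : c < 1)
    (hlim : Tendsto (fun n => (f n : ℝ) / (g n : ℝ)) atTop (nhds c))
    (ρ : ℝ) (hρ : ρ ∈ densSet f) :
    c ^ 2 * ρ ∈ densSet g := by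
  obtain ⟨⟨hρ0, hρ1⟩, V, hV, hne, hdens⟩ := hρ
  refine ⟨⟨by positivity, mul_le_one₀ (pow_le_one₀ hc0.le hc1.le) hρ0 hρ1⟩, V,
    fun n hn p hp => (hV n hn p hp).mono (hle n), hne, ?_⟩
  refine (((tendsto_two_mul_add_one_div hg hlim).pow 2).mul hdens).congr fun n => ?_
  have hfn : (2 * (f n : ℝ) + 1) ≠ 0 := by positivity
  simp only [densitySeq, burnSet_eq_of_le hf hle hV]
  field_simp
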